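/- Let N ≥ 4 and α ∈ ℝ. Then inf{ ∫_{ℝ^N} |(i∇−𝒜)φ|² dx / ∫_{ℝ^N} |φ(x)|²/(x₁²+x₂²) dx : φ ∈ C_c^∞(ℝ^N ∖ Σ, ℂ), φ ≢ 0 } = inf{ ∫_{ℝ²} |(i∇−𝒜₂)ψ|² dz / ∫_{ℝ²} |ψ(z)|²/|z|² dz : ψ ∈ C_c^∞(ℝ² ∖ {0}, ℂ), ψ ≢ 0 }, where 𝒜₂(z) = α(−z₂, z₁)/|z|²; that is, the best constant in the N-dimensional Aharonov–Bohm Hardy-type inequality equals the two-dimensional one. -/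

import Mathlib

open MeasureTheory Complex Filter Metric

/-- the `i`-th coordinate of a point of `ℝ^N` (junk value `0` if `i ≥ N`). -/
noncomputable def coord (N : ℕ) (i : ℕ) (x : EuclideanSpace ℝ (Fin N)) : ℝ :=
  if h : i < N then x ⟨i, h⟩ else 0

/-- the Aharonov–Bohm potential
`𝒜(x) = (−α x₂/(x₁²+x₂²), α x₁/(x₁²+x₂²), 0, …, 0)`. -/
noncomputable def abPot (N : ℕ) (α : ℝ) (x : EuclideanSpace ℝ (Fin N)) :
    EuclideanSpace ℝ (Fin N) :=
  (EuclideanSpace.equiv (Fin N) ℝ).symm fun i =>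
    if (i : ℕ) = 0 then -α * coord N 1 x / (coord N 0 x ^ 2 + coord N 1 x ^ 2)
    else if (i : ℕ) = 1 then α * coord N 0 x / (coord N 0 x ^ 2 + coord N 1 x ^ 2)
    else 0

/-- the singular set `Σ = {x : x₁ = x₂ = 0}` of the Aharonov–Bohm potential. -/
def ABsing (N : ℕ) : Set (EuclideanSpace ℝ (Fin N)) :=
  {x | coord N 0 x = 0 ∧ coord N 1 x = 0}

/-- squared pointwise norm of `(i∇−𝒜)φ(x) = i∇φ(x) − 𝒜(x)φ(x)`. -/
noncomputable def abGrad2 (N : ℕ) (α : ℝ) (φ : EuclideanSpace ℝ (Fin N) → ℂ)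
    (x : EuclideanSpace ℝ (Fin N)) : ℝ :=
  ∑ j : Fin N, ‖Complex.I * fderiv ℝ φ x (EuclideanSpace.single j 1)
      - ((abPot N α x j : ℝ) : ℂ) * φ x‖ ^ 2

/-- `min_{j ∈ ℤ} |j − α|`. -/
noncomputable def minDist (α : ℝ) : ℝ :=
  sInf { t : ℝ | ∃ j : ℤ, t = |(j : ℝ) - α| }

/-- the set of Hardy–Rayleigh quotients
`∫ |(i∇−𝒜)φ|² / ∫ |φ|²/(x₁²+x₂²)` over `φ ∈ C_c^∞(ℝ^N∖Σ)∖{0}`. -/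
def abHardyQuot (N : ℕ) (α : ℝ) : Set ℝ :=
  { r : ℝ | ∃ φ : EuclideanSpace ℝ (Fin N) → ℂ, ContDiff ℝ (⊤ : ℕ∞) φ ∧ HasCompactSupport φ ∧
      Disjoint (tsupport φ) (ABsing N) ∧ φ ≠ 0 ∧
      r = (∫ x, abGrad2 N α φ x) /
        ∫ x, ‖φ x‖ ^ 2 / (coord N 0 x ^ 2 + coord N 1 x ^ 2) }

abbrev EE (n : ℕ) := EuclideanSpace ℝ (Fin n)
noncomputable def JJ (m : ℕ) : EE (2+m) ≃L[ℝ] EE 2 × EE m := EuclideanSpace.finAddEquivProd (𝕜 := ℝ) (n := 2) (m := m)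

lemma JJ_fst (m : ℕ) (x : EE (2+m)) (i : Fin 2) : (JJ m x).1 i = x (Fin.castAdd m i) := by
  rfl
lemma JJ_snd (m : ℕ) (x : EE (2+m)) (i : Fin m) : (JJ m x).2 i = x (Fin.natAdd 2 i) := by
  rfl

lemma JJ_mp (m : ℕ) : MeasurePreserving (JJ m) volume volume := by
  have h1 := PiLp.volume_preserving_ofLp (Fin (2+m))
  have h2 := volume_measurePreserving_piCongrLeft (fun _ : Fin 2 ⊕ Fin m => ℝ) (finSumFinEquiv (m := 2) (n := m)).symm
  have h3 := volume_measurePreserving_sumPiEquivProdPi (fun _ : Fin 2 ⊕ Fin m => ℝ)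
  have h4 := (PiLp.volume_preserving_toLp (Fin 2)).prod (PiLp.volume_preserving_toLp (Fin m))
  have := h4.comp (h3.comp (h2.comp h1))
  have e : ⇑(JJ m) = Prod.map (WithLp.toLp 2) (WithLp.toLp 2) ∘
      ⇑(MeasurableEquiv.sumPiEquivProdPi fun _ : Fin 2 ⊕ Fin m => ℝ) ∘
        ⇑(MeasurableEquiv.piCongrLeft (fun _ : Fin 2 ⊕ Fin m => ℝ)
          (finSumFinEquiv (m := 2) (n := m)).symm) ∘ WithLp.ofLp := by
    have key : ∀ (f : Fin (2+m) → ℝ) (i : Fin 2 ⊕ Fin m),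
        MeasurableEquiv.piCongrLeft (fun _ : Fin 2 ⊕ Fin m => ℝ)
          (finSumFinEquiv (m := 2) (n := m)).symm f i = f (finSumFinEquiv i) := by
      intro f i
      simp [MeasurableEquiv.coe_piCongrLeft, Equiv.piCongrLeft_apply]
    funext x
    refine Prod.ext ?_ ?_
    · ext i
      rw [JJ_fst]
      exact (key x.ofLp (Sum.inl i)).symm
    · ext i
      rw [JJ_snd]
      exact (key x.ofLp (Sum.inr i)).symm
  rw [e]
  exact this
lemma JJ_symm_single_fst (m : ℕ) (i : Fin 2) :
    (JJ m) (EuclideanSpace.single (Fin.castAdd m i) 1) = (EuclideanSpace.single i 1, 0) := by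
  refine Prod.ext ?_ ?_
  · ext j; rw [JJ_fst]; simp
  · ext j; rw [JJ_snd]; simp [Fin.ext_iff]; omega
lemma JJ_symm_single_snd (m : ℕ) (i : Fin m) :
    (JJ m) (EuclideanSpace.single (Fin.natAdd 2 i) 1) = (0, EuclideanSpace.single i 1) := by
  refine Prod.ext ?_ ?_
  · ext j; rw [JJ_fst]; simp [Fin.ext_iff]; omega
  · ext j; rw [JJ_snd]; simp

lemma coord0 (m : ℕ) (x : EE (2+m)) : coord (2+m) 0 x = coord 2 0 (JJ m x).1 := by
  simp only [coord, dif_pos (show 0 < 2+m by omega), dif_pos (show 0 < 2 by omega)]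
  rfl
lemma coord1 (m : ℕ) (x : EE (2+m)) : coord (2+m) 1 x = coord 2 1 (JJ m x).1 := by
  simp only [coord, dif_pos (show 1 < 2+m by omega), dif_pos (show 1 < 2 by omega)]
  rfl
lemma abPot_cast (m : ℕ) (α : ℝ) (x : EE (2+m)) (j : Fin 2) :
    abPot (2+m) α x (Fin.castAdd m j) = abPot 2 α (JJ m x).1 j := by
  simp only [abPot, coord0, coord1]
  rfl
lemma abPot_nat (m : ℕ) (α : ℝ) (x : EE (2+m)) (j : Fin m) :
    abPot (2+m) α x (Fin.natAdd 2 j) = 0 := by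
  have h0 : ((Fin.natAdd 2 j : Fin (2+m)) : ℕ) ≠ 0 := by simp
  have h1 : ((Fin.natAdd 2 j : Fin (2+m)) : ℕ) ≠ 1 := by simp; omega
  simp only [abPot, EuclideanSpace.equiv, PiLp.continuousLinearEquiv_symm_apply, if_neg h0, if_neg h1]

lemma coord_cont (N i : ℕ) : Continuous (coord N i) := by
  unfold coord
  split_ifs
  · fun_prop
  · fun_prop

structure Adm (N : ℕ) (φ : EE N → ℂ) : Prop where
  smooth : ContDiff ℝ (⊤ : ℕ∞) φ
  comp : HasCompactSupport φ
  disj : Disjoint (tsupport φ) (ABsing N)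

lemma den_pos {N : ℕ} {x : EE N} (hx : x ∉ ABsing N) :
    0 < coord N 0 x ^ 2 + coord N 1 x ^ 2 := by
  by_contra h
  apply hx
  constructor <;> nlinarith [sq_nonneg (coord N 0 x), sq_nonneg (coord N 1 x)]

lemma Adm.cont_grad {N : ℕ} {φ : EE N → ℂ} (h : Adm N φ) (α : ℝ) : Continuous (abGrad2 N α φ) := by
  rw [continuous_iff_continuousAt]
  intro x
  have hf : Continuous (fderiv ℝ φ) := h.smooth.continuous_fderiv (by simp)
  have hc0 := coord_cont N 0
  have hc1 := coord_cont N 1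
  by_cases hx : x ∈ tsupport φ
  · have hd := (den_pos (Set.disjoint_left.1 h.disj hx)).ne'
    have hA : ∀ j, ContinuousAt (fun x => abPot N α x j) x := by
      intro j
      simp only [abPot, EuclideanSpace.equiv, PiLp.continuousLinearEquiv_symm_apply]
      split_ifs
      · exact ContinuousAt.div (by fun_prop) (by fun_prop) hd
      · exact ContinuousAt.div (by fun_prop) (by fun_prop) hd
      · exact continuousAt_const
    have hp := h.smooth.continuous
    unfold abGrad2
    refine tendsto_finsetSum _ fun j _ => ?_
    have h2 : ContinuousAt (fun x => ((abPot N α x j : ℝ) : ℂ)) x :=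
      Complex.continuous_ofReal.continuousAt.comp (hA j)
    have h3 : ContinuousAt (fun x => fderiv ℝ φ x (EuclideanSpace.single j 1)) x := by fun_prop
    exact (((continuousAt_const.mul h3).sub (h2.mul hp.continuousAt)).norm.pow 2)
  · have h1 : φ =ᶠ[nhds x] 0 := notMem_tsupport_iff_eventuallyEq.1 hx
    have h2 : abGrad2 N α φ =ᶠ[nhds x] fun _ => 0 := by
      filter_upwards [h1, h1.fderiv (𝕜 := ℝ)] with y h1 h2
      simp [abGrad2, h1, h2]
    exact continuousAt_const.congr h2.symm

lemma Adm.cont_den {N : ℕ} {φ : EE N → ℂ} (h : Adm N φ) :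
    Continuous fun x => ‖φ x‖ ^ 2 / (coord N 0 x ^ 2 + coord N 1 x ^ 2) := by
  rw [continuous_iff_continuousAt]
  intro x
  have hc0 := coord_cont N 0
  have hc1 := coord_cont N 1
  have hp := h.smooth.continuous
  by_cases hx : x ∈ tsupport φ
  · have hd := (den_pos (Set.disjoint_left.1 h.disj hx)).ne'
    exact ContinuousAt.div (by fun_prop) (by fun_prop) hd
  · have h1 : φ =ᶠ[nhds x] 0 := notMem_tsupport_iff_eventuallyEq.1 hx
    refine (continuousAt_const (y := (0:ℝ))).congr (EventuallyEq.symm ?_)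
    filter_upwards [h1] with y h1
    simp [h1]

lemma Adm.comp_grad {N : ℕ} {φ : EE N → ℂ} (h : Adm N φ) (α : ℝ) :
    HasCompactSupport (abGrad2 N α φ) := by
  refine h.comp.mono' fun x hx => ?_
  by_contra hx'
  have h1 : φ =ᶠ[nhds x] 0 := notMem_tsupport_iff_eventuallyEq.1 hx'
  apply hx
  have := h1.fderiv_eq (𝕜 := ℝ)
  simp [abGrad2, this, h1.eq_of_nhds]

lemma Adm.comp_den {N : ℕ} {φ : EE N → ℂ} (h : Adm N φ) :
    HasCompactSupport fun x => ‖φ x‖ ^ 2 / (coord N 0 x ^ 2 + coord N 1 x ^ 2) := by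
  refine h.comp.mono fun x hx => ?_
  contrapose! hx
  simp at hx
  simp [hx]

lemma Adm.int_grad {N : ℕ} {φ : EE N → ℂ} (h : Adm N φ) (α : ℝ) : Integrable (abGrad2 N α φ) :=
  (h.cont_grad α).integrable_of_hasCompactSupport (h.comp_grad α)

lemma Adm.int_den {N : ℕ} {φ : EE N → ℂ} (h : Adm N φ) :
    Integrable fun x => ‖φ x‖ ^ 2 / (coord N 0 x ^ 2 + coord N 1 x ^ 2) :=
  h.cont_den.integrable_of_hasCompactSupport h.comp_den

lemma Adm.den_pos {N : ℕ} {φ : EE N → ℂ} (h : Adm N φ) (h0 : φ ≠ 0) :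
    0 < ∫ x, ‖φ x‖ ^ 2 / (coord N 0 x ^ 2 + coord N 1 x ^ 2) := by
  obtain ⟨x, hx⟩ := Function.ne_iff.1 h0
  refine h.cont_den.integral_pos_of_hasCompactSupport_nonneg_nonzero h.comp_den
    (fun x => by simp only [Pi.zero_apply]; positivity) (x := x) ?_
  have := _root_.den_pos (Set.disjoint_left.1 h.disj (subset_tsupport φ hx))
  have : 0 < ‖φ x‖ := norm_pos_iff.2 hx
  positivity

lemma grad_nonneg (N : ℕ) (α : ℝ) (φ : EE N → ℂ) (x) : 0 ≤ abGrad2 N α φ x :=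
  Finset.sum_nonneg fun _ _ => by positivity

lemma quot_bdd (N : ℕ) (α : ℝ) : BddBelow (abHardyQuot N α) := by
  refine ⟨0, ?_⟩
  rintro r ⟨φ, -, -, -, -, rfl⟩
  exact div_nonneg (integral_nonneg (grad_nonneg N α φ)) (integral_nonneg fun x => by
    simp only [Pi.zero_apply]; positivity)

lemma quot_nonempty (α : ℝ) : (abHardyQuot 2 α).Nonempty := by
  let c : EE 2 := EuclideanSpace.single 0 1
  let b : ContDiffBump c := ⟨1/4, 1/2, by norm_num, by norm_num⟩
  refine ⟨_, fun x => (b x : ℂ), ?_, ?_, ?_, ?_, rfl⟩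
  · exact Complex.ofRealCLM.contDiff.comp b.contDiff
  · exact b.hasCompactSupport.comp_left (g := ((↑) : ℝ → ℂ)) rfl
  · rw [Set.disjoint_left]
    intro x hx hs
    have h1 : x ∈ tsupport b := by
      refine closure_mono ?_ hx
      intro y hy; simpa using hy
    rw [b.tsupport_eq] at h1
    have h2 : dist x c ≤ 1/2 := h1
    have h3 : ‖(x - c) 0‖ ≤ ‖x - c‖ := PiLp.norm_apply_le _ _
    have h4 : x 0 = 0 := by simpa [coord] using hs.1
    rw [dist_eq_norm] at h2
    have : (x - c) 0 = -1 := by simp [c, h4]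
    rw [this] at h3
    norm_num at h3
    linarith
  · intro h
    have h1 := congrFun h c
    have h2 : b c = 1 := b.one_of_mem_closedBall (by simp [b])
    simp [h2] at h1

lemma JJ_symm_add (m : ℕ) (z : EE 2) (y : EE m) :
    JJ m ((JJ m).symm (z, y)) = (z, y) := (JJ m).apply_symm_apply _

lemma grad_split (m : ℕ) (α : ℝ) (φ : EE (2+m) → ℂ) (x : EE (2+m)) :
    abGrad2 (2+m) α φ x =
      (∑ j : Fin 2, ‖Complex.I * fderiv ℝ φ x (EuclideanSpace.single (Fin.castAdd m j) 1)
        - ((abPot 2 α (JJ m x).1 j : ℝ) : ℂ) * φ x‖ ^ 2) +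
      ∑ k : Fin m, ‖fderiv ℝ φ x (EuclideanSpace.single (Fin.natAdd 2 k) 1)‖ ^ 2 := by
  unfold abGrad2
  rw [Fin.sum_univ_add]
  congr 1
  · refine Finset.sum_congr rfl fun j _ => ?_
    rw [abPot_cast]
  · refine Finset.sum_congr rfl fun j _ => ?_
    rw [abPot_nat]
    simp

/-- slices -/
noncomputable def slice (m : ℕ) (φ : EE (2+m) → ℂ) (y : EE m) (z : EE 2) : ℂ := φ ((JJ m).symm (z, y))

lemma slice_embed (m : ℕ) (y : EE m) :
    Topology.IsClosedEmbedding (fun z : EE 2 => (JJ m).symm (z, y)) := by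
  refine (JJ m).symm.toHomeomorph.isClosedEmbedding.comp ?_
  exact Topology.IsClosedEmbedding.of_continuous_injective_isClosedMap (by fun_prop)
    (fun a b h => (Prod.ext_iff.1 h).1) (fun s hs => by
      have : (fun z : EE 2 => (z, y)) '' s = s ×ˢ {y} := by
        ext ⟨a, b⟩; simp [Prod.ext_iff]; tauto
      rw [this]; exact hs.prod isClosed_singleton)

lemma slice_adm {m : ℕ} {φ : EE (2+m) → ℂ} (h : Adm (2+m) φ) (y : EE m) :
    Adm 2 (slice m φ y) := by
  refine ⟨?_, ?_, ?_⟩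
  · exact h.smooth.comp ((JJ m).symm.contDiff.comp (contDiff_id.prodMk contDiff_const))
  · exact h.comp.comp_isClosedEmbedding (slice_embed m y)
  · rw [Set.disjoint_left]
    intro z hz hs
    have h1 : (JJ m).symm (z, y) ∈ tsupport φ :=
      tsupport_comp_subset_preimage φ (slice_embed m y).continuous hz
    refine Set.disjoint_left.1 h.disj h1 ⟨?_, ?_⟩
    · rw [coord0, JJ_symm_add]; exact hs.1
    · rw [coord1, JJ_symm_add]; exact hs.2

lemma slice_fderiv {m : ℕ} {φ : EE (2+m) → ℂ} (h : Adm (2+m) φ) (y : EE m) (z : EE 2) (j : Fin 2) :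
    fderiv ℝ (slice m φ y) z (EuclideanSpace.single j 1) =
      fderiv ℝ φ ((JJ m).symm (z, y)) (EuclideanSpace.single (Fin.castAdd m j) 1) := by
  have h1 : HasFDerivAt φ (fderiv ℝ φ ((JJ m).symm (z, y))) ((JJ m).symm (z, y)) :=
    ((h.smooth.differentiable (by simp)) _).hasFDerivAt
  have h2 : HasFDerivAt (fun z : EE 2 => (JJ m).symm (z, y))
      (((JJ m).symm : EE 2 × EE m →L[ℝ] EE (2+m)).comp
        ((ContinuousLinearMap.id ℝ (EE 2)).prod (0 : EE 2 →L[ℝ] EE m))) z :=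
    ((JJ m).symm : EE 2 × EE m →L[ℝ] EE (2+m)).hasFDerivAt.comp z
      ((hasFDerivAt_id z).prodMk (hasFDerivAt_const y z))
  have h3 : HasFDerivAt (slice m φ y) _ z := h1.comp z h2
  rw [h3.fderiv]
  simp only [ContinuousLinearMap.comp_apply, ContinuousLinearMap.prod_apply,
    ContinuousLinearMap.id_apply, _root_.zero_apply]
  rw [← JJ_symm_single_fst]
  simp

lemma slice_grad_le {m : ℕ} {φ : EE (2+m) → ℂ} (h : Adm (2+m) φ) (α : ℝ) (y : EE m) (z : EE 2) :
    abGrad2 2 α (slice m φ y) z ≤ abGrad2 (2+m) α φ ((JJ m).symm (z, y)) := by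
  rw [grad_split, JJ_symm_add]
  refine le_trans (le_of_eq ?_) (le_add_of_nonneg_right (Finset.sum_nonneg fun _ _ => by positivity))
  unfold abGrad2
  refine Finset.sum_congr rfl fun j _ => ?_
  rw [slice_fderiv h]
  rfl

lemma JJ_symm_mp (m : ℕ) : MeasurePreserving (JJ m).symm (volume.prod volume) volume :=
  MeasurePreserving.symm (JJ m).toHomeomorph.toMeasurableEquiv (JJ_mp m)

lemma JJ_integral (m : ℕ) (f : EE (2+m) → ℝ) :
    ∫ x, f x = ∫ p : EE 2 × EE m, f ((JJ m).symm p) ∂(volume.prod volume) :=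
  ((JJ_symm_mp m).integral_comp (JJ m).symm.toHomeomorph.measurableEmbedding f).symm

lemma JJ_integrable {m : ℕ} {f : EE (2+m) → ℝ} (hf : Integrable f) :
    Integrable (fun p : EE 2 × EE m => f ((JJ m).symm p)) (volume.prod volume) :=
  (JJ_symm_mp m).integrable_comp_of_integrable hf

lemma two_bound {φ : EE 2 → ℂ} (h : Adm 2 φ) (α : ℝ) :
    sInf (abHardyQuot 2 α) * ∫ x, ‖φ x‖ ^ 2 / (coord 2 0 x ^ 2 + coord 2 1 x ^ 2) ≤
      ∫ x, abGrad2 2 α φ x := by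
  by_cases h0 : φ = 0
  · have : 0 ≤ ∫ x, abGrad2 2 α φ x := integral_nonneg (grad_nonneg 2 α φ)
    have h1 : ∫ x, ‖φ x‖ ^ 2 / (coord 2 0 x ^ 2 + coord 2 1 x ^ 2) = 0 := by simp [h0]
    rw [h1]; simpa using this
  · rw [← le_div_iff₀ (h.den_pos h0)]
    exact csInf_le (quot_bdd 2 α) ⟨φ, h.smooth, h.comp, h.disj, h0, rfl⟩

lemma lower {m : ℕ} {φ : EE (2+m) → ℂ} (h : Adm (2+m) φ) (α : ℝ) :
    sInf (abHardyQuot 2 α) * ∫ x, ‖φ x‖ ^ 2 / (coord (2+m) 0 x ^ 2 + coord (2+m) 1 x ^ 2) ≤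
      ∫ x, abGrad2 (2+m) α φ x := by
  have hG := JJ_integrable (h.int_grad α)
  have hD := JJ_integrable h.int_den
  rw [JJ_integral, JJ_integral m (abGrad2 (2+m) α φ), integral_prod_symm _ hG,
    integral_prod_symm _ hD, ← integral_const_mul]
  refine integral_mono_ae (hD.integral_prod_right.const_mul _) hG.integral_prod_right ?_
  filter_upwards [hG.prod_left_ae] with y hy
  have h1 := two_bound (slice_adm h y) α
  have h2 : ∫ z, abGrad2 2 α (slice m φ y) z ≤ ∫ z, abGrad2 (2+m) α φ ((JJ m).symm (z, y)) :=
    integral_mono_of_nonneg (Filter.Eventually.of_forall (grad_nonneg _ _ _)) hy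
      (Filter.Eventually.of_forall (slice_grad_le h α y))
  refine le_trans (le_of_eq ?_) (h1.trans h2)
  congr 1
  refine integral_congr_ae (Filter.Eventually.of_forall fun z => ?_)
  simp only [coord0, coord1, JJ_symm_add, slice]

/-- tensor products -/
noncomputable def tens (m : ℕ) (ψ : EE 2 → ℂ) (χ : EE m → ℝ) (x : EE (2+m)) : ℂ :=
  ψ (JJ m x).1 * (χ (JJ m x).2 : ℂ)

lemma tens_adm {m : ℕ} {ψ : EE 2 → ℂ} (h : Adm 2 ψ) {χ : EE m → ℝ}
    (hc : ContDiff ℝ (⊤ : ℕ∞) χ) (hs : HasCompactSupport χ) : Adm (2+m) (tens m ψ χ) := by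
  have hsub : Function.support (tens m ψ χ) ⊆ (JJ m) ⁻¹' (tsupport ψ ×ˢ tsupport χ) := by
    intro x hx
    simp only [tens, Function.mem_support, mul_ne_zero_iff, Complex.ofReal_ne_zero] at hx
    exact ⟨subset_tsupport _ hx.1, subset_tsupport _ hx.2⟩
  have hcl : IsClosed ((JJ m) ⁻¹' (tsupport ψ ×ˢ tsupport χ)) :=
    ((isClosed_tsupport _).prod (isClosed_tsupport _)).preimage (JJ m).continuous
  have hco : IsCompact ((JJ m) ⁻¹' (tsupport ψ ×ˢ tsupport χ)) :=
    (JJ m).toHomeomorph.isCompact_preimage.2 (IsCompact.prod h.comp hs)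
  have hsub' : tsupport (tens m ψ χ) ⊆ (JJ m) ⁻¹' (tsupport ψ ×ˢ tsupport χ) :=
    closure_minimal hsub hcl
  refine ⟨?_, ?_, ?_⟩
  · refine ContDiff.mul ?_ ?_
    · exact h.smooth.comp (contDiff_fst.comp (JJ m).contDiff)
    · exact Complex.ofRealCLM.contDiff.comp (hc.comp (contDiff_snd.comp (JJ m).contDiff))
  · exact hco.of_isClosed_subset (isClosed_tsupport _) hsub'
  · rw [Set.disjoint_left]
    intro x hx hxs
    refine Set.disjoint_left.1 h.disj (hsub' hx).1 ⟨?_, ?_⟩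
    · rw [← coord0]; exact hxs.1
    · rw [← coord1]; exact hxs.2

lemma tens_fderiv {m : ℕ} {ψ : EE 2 → ℂ} (h : Adm 2 ψ) {χ : EE m → ℝ}
    (hc : ContDiff ℝ (⊤ : ℕ∞) χ) (x v : EE (2+m)) :
    fderiv ℝ (tens m ψ χ) x v =
      ψ (JJ m x).1 * (fderiv ℝ χ (JJ m x).2 (JJ m v).2 : ℝ) +
      (χ (JJ m x).2 : ℂ) * fderiv ℝ ψ (JJ m x).1 (JJ m v).1 := by
  have h1 : HasFDerivAt ψ (fderiv ℝ ψ (JJ m x).1) (JJ m x).1 :=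
    ((h.smooth.differentiable (by simp)) _).hasFDerivAt
  have h2 : HasFDerivAt χ (fderiv ℝ χ (JJ m x).2) (JJ m x).2 :=
    ((hc.differentiable (by simp)) _).hasFDerivAt
  have hJ : HasFDerivAt (JJ m) ((JJ m) : EE (2+m) →L[ℝ] EE 2 × EE m) x := (JJ m).hasFDerivAt
  have h3 : HasFDerivAt (fun x => ψ (JJ m x).1) _ x := h1.comp x hJ.fst
  have h4 : HasFDerivAt (fun x => χ (JJ m x).2) _ x := h2.comp x hJ.snd
  have h5 : HasFDerivAt (fun x => (χ (JJ m x).2 : ℂ)) _ x :=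
    Complex.ofRealCLM.hasFDerivAt.comp x h4
  have h6 : HasFDerivAt (tens m ψ χ) _ x := h3.mul h5
  rw [h6.fderiv]
  simp

/-- real gradient squared -/
noncomputable def rg {m : ℕ} (χ : EE m → ℝ) (y : EE m) : ℝ :=
  ∑ k : Fin m, (fderiv ℝ χ y (EuclideanSpace.single k 1)) ^ 2

lemma tens_grad {m : ℕ} {ψ : EE 2 → ℂ} (h : Adm 2 ψ) {χ : EE m → ℝ}
    (hc : ContDiff ℝ (⊤ : ℕ∞) χ) (α : ℝ) (x : EE (2+m)) :
    abGrad2 (2+m) α (tens m ψ χ) x =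
      abGrad2 2 α ψ (JJ m x).1 * χ (JJ m x).2 ^ 2 + ‖ψ (JJ m x).1‖ ^ 2 * rg χ (JJ m x).2 := by
  rw [grad_split]
  congr 1
  · unfold abGrad2
    rw [Finset.sum_mul]
    refine Finset.sum_congr rfl fun j _ => ?_
    rw [tens_fderiv h hc, JJ_symm_single_fst]
    simp only [map_zero, Complex.ofReal_zero, mul_zero, zero_add, tens]
    rw [← sq_abs (χ _), ← Real.norm_eq_abs, ← Complex.norm_real, ← mul_pow, ← norm_mul]
    congr 2
    ring
  · unfold rg
    rw [Finset.mul_sum]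
    refine Finset.sum_congr rfl fun j _ => ?_
    rw [tens_fderiv h hc, JJ_symm_single_snd]
    simp only [map_zero, mul_zero, add_zero, norm_mul, Complex.norm_real, Real.norm_eq_abs, mul_pow,
      sq_abs]

lemma rg_cont {m : ℕ} {χ : EE m → ℝ} (hc : ContDiff ℝ (⊤ : ℕ∞) χ) : Continuous (rg χ) := by
  have hf : Continuous (fderiv ℝ χ) := hc.continuous_fderiv (by simp)
  unfold rg
  fun_prop

lemma rg_comp {m : ℕ} {χ : EE m → ℝ} (hs : HasCompactSupport χ) : HasCompactSupport (rg χ) := by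
  refine hs.mono' fun x hx => ?_
  by_contra hx'
  have h1 : χ =ᶠ[nhds x] 0 := notMem_tsupport_iff_eventuallyEq.1 hx'
  apply hx
  have := h1.fderiv_eq (𝕜 := ℝ)
  simp [rg, this]

lemma tens_int_grad {m : ℕ} {ψ : EE 2 → ℂ} (h : Adm 2 ψ) {χ : EE m → ℝ}
    (hc : ContDiff ℝ (⊤ : ℕ∞) χ) (hs : HasCompactSupport χ) (α : ℝ) :
    ∫ x, abGrad2 (2+m) α (tens m ψ χ) x =
      (∫ z, abGrad2 2 α ψ z) * (∫ y, χ y ^ 2) + (∫ z, ‖ψ z‖ ^ 2) * ∫ y, rg χ y := by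
  have hc' := hc.continuous
  have hp' := h.smooth.continuous
  have i1 : Integrable (fun y => χ y ^ 2) :=
    (by fun_prop : Continuous fun y => χ y ^ 2).integrable_of_hasCompactSupport
      (hs.comp_left (g := fun t : ℝ => t ^ 2) (by simp))
  have i2 : Integrable (fun z => ‖ψ z‖ ^ 2) :=
    (by fun_prop : Continuous fun y => ‖ψ y‖ ^ 2).integrable_of_hasCompactSupport
      (h.comp.comp_left (g := fun t : ℂ => ‖t‖ ^ 2) (by simp))
  have i3 : Integrable (rg χ) := (rg_cont hc).integrable_of_hasCompactSupport (rg_comp hs)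
  rw [JJ_integral]
  simp only [tens_grad h hc, (JJ m).apply_symm_apply]
  rw [integral_add ((h.int_grad α).mul_prod i1) (i2.mul_prod i3),
    integral_prod_mul (abGrad2 2 α ψ) (fun y => χ y ^ 2),
    integral_prod_mul (fun z => ‖ψ z‖ ^ 2) (rg χ)]

lemma tens_int_den {m : ℕ} (ψ : EE 2 → ℂ) (χ : EE m → ℝ) :
    ∫ x, ‖tens m ψ χ x‖ ^ 2 / (coord (2+m) 0 x ^ 2 + coord (2+m) 1 x ^ 2) =
      (∫ z, ‖ψ z‖ ^ 2 / (coord 2 0 z ^ 2 + coord 2 1 z ^ 2)) * (∫ y, χ y ^ 2) := by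
  rw [JJ_integral, ← integral_prod_mul]
  refine integral_congr_ae (Filter.Eventually.of_forall fun p => ?_)
  simp only [coord0, coord1, tens, (JJ m).apply_symm_apply, norm_mul, Complex.norm_real,
    Real.norm_eq_abs, mul_pow, sq_abs]
  ring

lemma rg_smul {m : ℕ} (χ : EE m → ℝ) (t : ℝ) (y : EE m) :
    rg (fun y => χ (t • y)) y = t ^ 2 * rg χ (t • y) := by
  unfold rg
  rw [fderiv_comp_smul, Finset.mul_sum]
  simp [mul_pow]

lemma upper {m : ℕ} {ψ : EE 2 → ℂ} (h : Adm 2 ψ) (h0 : ψ ≠ 0) (α : ℝ) :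
    ∃ C : ℝ, ∀ t : ℝ, 0 < t → ((∫ z, abGrad2 2 α ψ z) /
      (∫ z, ‖ψ z‖ ^ 2 / (coord 2 0 z ^ 2 + coord 2 1 z ^ 2)) + C * t ^ 2)
        ∈ abHardyQuot (2+m) α := by
  let b : ContDiffBump (0 : EE m) := ⟨1, 2, by norm_num, by norm_num⟩
  have hD := h.den_pos h0
  have hbc : Continuous fun y => b y ^ 2 := b.continuous.pow 2
  have hb : 0 < ∫ y, b y ^ 2 := by
    refine hbc.integral_pos_of_hasCompactSupport_nonneg_nonzero
      (b.hasCompactSupport.comp_left (g := fun t : ℝ => t ^ 2) (by simp))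
      (fun y => by simp only [Pi.zero_apply]; positivity) (x := 0) ?_
    have : b 0 = 1 := b.one_of_mem_closedBall (by simp [b])
    simp [this]
  refine ⟨(∫ z, ‖ψ z‖ ^ 2) * (∫ y, rg b y) /
    ((∫ z, ‖ψ z‖ ^ 2 / (coord 2 0 z ^ 2 + coord 2 1 z ^ 2)) * (∫ y, b y ^ 2)), fun t ht => ?_⟩
  have hc : ContDiff ℝ (⊤ : ℕ∞) (fun y => b (t • y)) := b.contDiff.comp (contDiff_const_smul t)
  have hs : HasCompactSupport (fun y => b (t • y)) := b.hasCompactSupport.comp_smul ht.ne'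
  have ha := tens_adm h hc hs
  have e1 : ∫ y, (fun y => b (t • y)) y ^ 2 = (t ^ m)⁻¹ * ∫ y, b y ^ 2 := by
    have := Measure.integral_comp_smul volume (fun y => b y ^ 2) t
    simp only [finrank_euclideanSpace, Fintype.card_fin, smul_eq_mul] at this
    rw [abs_of_pos (by positivity)] at this
    exact this
  have e2 : ∫ y, rg (fun y => b (t • y)) y = t ^ 2 * ((t ^ m)⁻¹ * ∫ y, rg b y) := by
    have := Measure.integral_comp_smul volume (rg b) t
    simp only [finrank_euclideanSpace, Fintype.card_fin, smul_eq_mul] at this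
    rw [abs_of_pos (by positivity)] at this
    simp only [rg_smul]
    rw [integral_const_mul, this]
  have e3 := tens_int_grad h hc hs α
  have e4 := tens_int_den ψ (fun y => b (t • y))
  rw [e1] at e3 e4
  rw [e2] at e3
  refine ⟨_, ha.smooth, ha.comp, ha.disj, ?_, ?_⟩
  · intro hz
    have : (0:ℝ) < ∫ x, ‖tens m ψ (fun y => b (t • y)) x‖ ^ 2 /
        (coord (2+m) 0 x ^ 2 + coord (2+m) 1 x ^ 2) := by rw [e4]; positivity
    rw [hz] at this
    simp at this
  · rw [e3, e4]
    have := pow_pos ht m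
    field_simp

/-- the best constant in the `N`-dimensional Aharonov–Bohm Hardy
inequality equals the two-dimensional one. -/
theorem stmt_17 (N : ℕ) (hN : 4 ≤ N) (α : ℝ) :
    sInf (abHardyQuot N α) = sInf (abHardyQuot 2 α) := by
  obtain ⟨m, rfl⟩ : ∃ m, N = 2 + m := ⟨N - 2, by omega⟩
  apply le_antisymm
  · refine le_csInf (quot_nonempty α) ?_
    rintro r ⟨ψ, h1, h2, h3, h0, rfl⟩
    obtain ⟨C, hC⟩ := upper (m := m) (⟨h1, h2, h3⟩ : Adm 2 ψ) h0 α
    have ht : Tendsto (fun t : ℝ => (∫ z, abGrad2 2 α ψ z) /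
      (∫ z, ‖ψ z‖ ^ 2 / (coord 2 0 z ^ 2 + coord 2 1 z ^ 2)) + C * t ^ 2)
        (nhdsWithin 0 (Set.Ioi 0)) (nhds ((∫ z, abGrad2 2 α ψ z) /
      (∫ z, ‖ψ z‖ ^ 2 / (coord 2 0 z ^ 2 + coord 2 1 z ^ 2)))) := by
      refine tendsto_nhdsWithin_of_tendsto_nhds ?_
      refine Continuous.tendsto' (by fun_prop) _ _ (by simp)
    refine ge_of_tendsto ht ?_
    filter_upwards [self_mem_nhdsWithin] with t ht
    exact csInf_le (quot_bdd _ α) (hC t ht)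
  · refine le_csInf ?_ ?_
    · obtain ⟨r, ψ, h1, h2, h3, h0, rfl⟩ := quot_nonempty α
      obtain ⟨C, hC⟩ := upper (m := m) (⟨h1, h2, h3⟩ : Adm 2 ψ) h0 α
      exact ⟨_, hC 1 one_pos⟩
    · rintro r ⟨φ, h1, h2, h3, h0, rfl⟩
      have h : Adm (2+m) φ := ⟨h1, h2, h3⟩
      rw [le_div_iff₀ (h.den_pos h0)]
      exact lower h α
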